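/- Let ψ_d(y; μ, Ω, α, τ, κ, ν) be the d-dimensional non-central extended skew-t density. Let I be a nonempty proper subset of {1, …, d} with complement Ī, let d_I = |I|, and partition y = (y_I, y_Ī), μ, Ω, Ω̄ = ω⁻¹Ωω⁻¹ and α conformably. Define Ω̃_{ĪĪ·I} = Ω̄_{ĪĪ} − Ω̄_{ĪI} Ω̄_{II}⁻¹ Ω̄_{IĪ}, α*_I = (α_I + Ω̄_{II}⁻¹ Ω̄_{IĪ} α_Ī) / √(1 + α_Īᵀ Ω̃_{ĪĪ·I} α_Ī), τ*_I = τ / √(1 + α_Īᵀ Ω̃_{ĪĪ·I} α_Ī) and κ*_I = κ / √(1 + α_Īᵀ Ω̃_{ĪĪ·I} α_Ī). Then for every y_I ∈ ℝ^{d_I}, ∫_{ℝ^{d−d_I}} ψ_d(y; μ, Ω, α, τ, κ, ν) dy_Ī = ψ_{d_I}(y_I; μ_I, Ω_{II}, α*_I, τ*_I, κ*_I, ν); that is, the marginal of a non-central extended skew-t distribution is again non-central extended skew-t with these parameters. -/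

import Mathlib

open MeasureTheory Real Filter Matrix Set Topology Asymptotics

noncomputable section

/-- Standard normal density. -/
def nPdf (x : ℝ) : ℝ := (Real.sqrt (2 * π))⁻¹ * Real.exp (-(x ^ 2) / 2)

/-- Standard normal distribution function. -/
def nCdf (x : ℝ) : ℝ := ∫ u in Set.Iio x, nPdf u

/-- Centred multivariate normal density with covariance matrix `S`. -/
def mvnPdf {ι : Type*} [Fintype ι] [DecidableEq ι] (S : Matrix ι ι ℝ) (y : ι → ℝ) : ℝ :=
  (2 * π) ^ (-(Fintype.card ι : ℝ) / 2) * S.det ^ (-(1 : ℝ) / 2) *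
    Real.exp (-(y ⬝ᵥ S⁻¹.mulVec y) / 2)

/-- Centred multivariate normal distribution function. -/
def mvnCdf {ι : Type*} [Fintype ι] [DecidableEq ι] (S : Matrix ι ι ℝ) (w : ι → ℝ) : ℝ :=
  ∫ u in Set.univ.pi fun i => Set.Iic (w i), mvnPdf S u

/-- Multivariate central Student-t density with scale matrix `S` and `ν` degrees of freedom. -/
def tPdf {ι : Type*} [Fintype ι] [DecidableEq ι] (S : Matrix ι ι ℝ) (ν : ℝ) (y : ι → ℝ) : ℝ :=
  Real.Gamma ((ν + Fintype.card ι) / 2) *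
      (1 + y ⬝ᵥ S⁻¹.mulVec y / ν) ^ (-(ν + Fintype.card ι) / 2) /
    (Real.Gamma (ν / 2) * (ν * π) ^ ((Fintype.card ι : ℝ) / 2) * Real.sqrt S.det)

/-- Univariate non-central t distribution function with non-centrality `a`. -/
def nctCdf (x a ν : ℝ) : ℝ :=
  ∫ v in Set.Ioi (0 : ℝ),
    v ^ (ν / 2 - 1) * Real.exp (-v) / Real.Gamma (ν / 2) *
      nCdf (x * Real.sqrt (2 * v / ν) - a)

/-- Multivariate non-central t distribution function. -/
def mvnctCdf {ι : Type*} [Fintype ι] [DecidableEq ι]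
    (y : ι → ℝ) (S : Matrix ι ι ℝ) (κ : ι → ℝ) (ν : ℝ) : ℝ :=
  ∫ v in Set.Ioi (0 : ℝ),
    v ^ (ν / 2 - 1) * Real.exp (-v) / Real.Gamma (ν / 2) *
      mvnCdf S fun i => y i * Real.sqrt (2 * v / ν) - κ i

/-- Multivariate non-central t density (scale-mixture form). -/
def mvnctPdf {ι : Type*} [Fintype ι] [DecidableEq ι]
    (μ : ι → ℝ) (S : Matrix ι ι ℝ) (κ : ι → ℝ) (ν : ℝ) (y : ι → ℝ) : ℝ :=
  ∫ v in Set.Ioi (0 : ℝ),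
    v ^ (ν / 2 - 1) * Real.exp (-v) / Real.Gamma (ν / 2) *
      ((2 * v / ν) ^ ((Fintype.card ι : ℝ) / 2) *
        mvnPdf S fun i => Real.sqrt (2 * v / ν) * (y i - μ i) - κ i)

/-- Univariate non-central t density with location `μ`, scale (standard deviation) `s`,
non-centrality `κ` and `ν` degrees of freedom. -/
def nctPdf1 (μ s κ ν x : ℝ) : ℝ :=
  ∫ v in Set.Ioi (0 : ℝ),
    v ^ (ν / 2 - 1) * Real.exp (-v) / Real.Gamma (ν / 2) *
      (Real.sqrt (2 * v / ν) * s⁻¹ * nPdf (Real.sqrt (2 * v / ν) * (x - μ) / s - κ))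

/-- Non-central extended skew-t density. -/
def skewTPdf {ι : Type*} [Fintype ι] [DecidableEq ι]
    (μ : ι → ℝ) (Ω : Matrix ι ι ℝ) (α : ι → ℝ) (τ κ ν : ℝ) (y : ι → ℝ) : ℝ :=
  let d : ℝ := Fintype.card ι
  let ω : Matrix ι ι ℝ := Matrix.diagonal fun i => Real.sqrt (Ω i i)
  let Ωb : Matrix ι ι ℝ := ω⁻¹ * Ω * ω⁻¹
  let z : ι → ℝ := ω⁻¹.mulVec fun i => y i - μ i
  let Q : ℝ := α ⬝ᵥ Ωb.mulVec α
  tPdf Ω ν (fun i => y i - μ i) *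
      nctCdf ((α ⬝ᵥ z + τ) * Real.sqrt ((ν + d) / (ν + z ⬝ᵥ Ωb⁻¹.mulVec z))) κ (ν + d) /
    nctCdf (τ / Real.sqrt (1 + Q)) (κ / Real.sqrt (1 + Q)) ν

/-- Non-central extended skew-t distribution function. -/
def skewTCdf {ι : Type*} [Fintype ι] [DecidableEq ι]
    (μ : ι → ℝ) (Ω : Matrix ι ι ℝ) (α : ι → ℝ) (τ κ ν : ℝ) (y : ι → ℝ) : ℝ :=
  ∫ u in Set.univ.pi fun i => Set.Iic (y i), skewTPdf μ Ω α τ κ ν u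


section helpers
open ProbabilityTheory
open scoped NNReal ENNReal

lemma nPdf_eq (x : ℝ) : nPdf x = gaussianPDFReal 0 1 x := by
  simp [nPdf, gaussianPDFReal]

lemma nCdf_eq (x : ℝ) : nCdf x = (gaussianReal 0 1).real (Set.Iio x) := by
  rw [Measure.real, gaussianReal_apply_eq_integral 0 one_ne_zero, ENNReal.toReal_ofReal]
  · simp [nCdf, nPdf_eq]
  · exact integral_nonneg fun x => gaussianPDFReal_nonneg _ _ _

lemma nCdf_nonneg (x : ℝ) : 0 ≤ nCdf x := by rw [nCdf_eq]; positivity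

lemma nCdf_le_one (x : ℝ) : nCdf x ≤ 1 := by rw [nCdf_eq]; exact measureReal_le_one

lemma nCdf_mono : Monotone nCdf := by
  intro x y h
  rw [nCdf_eq, nCdf_eq]
  exact measureReal_mono (Set.Iio_subset_Iio h)

lemma measurable_nCdf : Measurable nCdf := nCdf_mono.measurable

lemma gaussian_Iio (w : ℝ≥0) (hw : w ≠ 0) (b : ℝ) :
    (gaussianReal 0 w).real (Set.Iio b) = nCdf (b / √(w : ℝ)) := by
  have hw' : 0 < (w : ℝ) := by positivity
  have hs : 0 < √(w : ℝ) := Real.sqrt_pos.2 hw'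
  have h : gaussianReal 0 w = (gaussianReal 0 1).map (√(w:ℝ) * ·) := by
    rw [gaussianReal_map_const_mul]
    congr 1
    · simp
    · ext; simp
  rw [h, map_measureReal_apply (by fun_prop) measurableSet_Iio, nCdf_eq]
  congr 1
  ext x
  simp only [Set.mem_preimage, Set.mem_Iio]
  rw [lt_div_iff₀ hs, mul_comm]

lemma gauss1 (w : ℝ≥0) (b : ℝ) :
    ∫ x, nCdf (x + b) ∂(gaussianReal 0 w) = nCdf (b / √(1 + (w:ℝ))) := by
  have hw : (1 + w) ≠ 0 := by positivity
  have h1 := gaussian_Iio (w + 1) (by positivity) b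
  have h2 : gaussianReal 0 (w + 1) = (gaussianReal 0 w) ∗ (gaussianReal 0 1) := by
    rw [gaussianReal_conv_gaussianReal]; simp
  push_cast at h1
  rw [add_comm (1:ℝ), ← h1, h2, Measure.real, ← lintegral_indicator_one measurableSet_Iio,
    Measure.lintegral_conv (by exact measurable_one.indicator measurableSet_Iio)]
  have h3 : ∀ x : ℝ, ∫⁻ y, (Set.Iio b).indicator (1 : ℝ → ℝ≥0∞) (x + y) ∂(gaussianReal 0 1)
      = ENNReal.ofReal (nCdf (-x + b)) := by
    intro x
    rw [nCdf_eq, Measure.real, ENNReal.ofReal_toReal (measure_ne_top _ _),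
      ← lintegral_indicator_one measurableSet_Iio]
    congr 1; ext y
    simp only [Set.indicator, Set.mem_Iio]
    have : (x + y < b) = (y < -x + b) := by
      apply propext; constructor <;> intro <;> linarith
    simp only [this, Pi.one_apply]
  simp_rw [h3]
  rw [← integral_eq_lintegral_of_nonneg_ae (ae_of_all _ fun x => nCdf_nonneg _)]
  · have h4 : gaussianReal 0 w = (gaussianReal 0 w).map (fun x => -x) := by
      rw [gaussianReal_map_neg]; simp
    conv_lhs => rw [h4]
    rw [integral_map (by fun_prop)]
    exact (measurable_nCdf.comp (by fun_prop)).aestronglyMeasurable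
  · exact (measurable_nCdf.comp (by fun_prop)).aestronglyMeasurable

variable {n : Type*} [Fintype n] 

lemma map_dot_pi (a : n → ℝ) :
    (Measure.pi (fun _ : n => gaussianReal 0 1)).map (fun u => a ⬝ᵥ u) =
      gaussianReal 0 (a ⬝ᵥ a).toNNReal := by
  have h0 : (fun u : n → ℝ => a ⬝ᵥ u) =
    (innerSL ℝ (WithLp.toLp 2 a : EuclideanSpace ℝ n)) ∘ (WithLp.toLp 2) := by
    ext u
    simp [PiLp.inner_apply, dotProduct, mul_comm]
  rw [h0, ← Measure.map_map (by fun_prop) (by fun_prop), map_pi_eq_stdGaussian,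
    IsGaussian.map_eq_gaussianReal, integral_strongDual_stdGaussian, variance_dual_stdGaussian,
    innerSL_apply_norm, EuclideanSpace.real_norm_sq_eq]
  simp [dotProduct, sq]

lemma pi_gaussian_eq : Measure.pi (fun _ : n => gaussianReal 0 1) =
    (volume : Measure (n → ℝ)).withDensity
      (fun u => ENNReal.ofReal (∏ i, gaussianPDFReal 0 1 (u i))) := by
  apply Measure.pi_eq
  intro s hs
  rw [withDensity_apply _ (MeasurableSet.univ_pi hs), volume_pi, Measure.restrict_pi_pi,
    ← ofReal_integral_eq_lintegral_ofReal, integral_fintype_prod_eq_prod,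
    ENNReal.ofReal_prod_of_nonneg]
  · refine Finset.prod_congr rfl fun i _ => ?_
    rw [gaussianReal_apply_eq_integral _ one_ne_zero]
  · intro i _
    exact integral_nonneg fun x => gaussianPDFReal_nonneg _ _ _
  · exact Integrable.fintype_prod (fun i => (integrable_gaussianPDFReal 0 1).restrict)
  · exact ae_of_all _ fun u => Finset.prod_nonneg fun i _ => gaussianPDFReal_nonneg _ _ _

lemma prod_pdf (u : n → ℝ) : ∏ i, gaussianPDFReal 0 1 (u i) =
    ((√(2 * π))⁻¹) ^ (Fintype.card n) * Real.exp (-(u ⬝ᵥ u) / 2) := by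
  simp only [gaussianPDFReal, Finset.prod_mul_distrib, ← Real.exp_sum]
  simp [dotProduct, sq, Finset.sum_div, neg_div]

lemma integral_pi_gaussian (f : (n → ℝ) → ℝ) :
    ∫ u, Real.exp (-(u ⬝ᵥ u) / 2) * f u = (√(2 * π)) ^ (Fintype.card n) *
      ∫ u, f u ∂(Measure.pi (fun _ : n => gaussianReal 0 1)) := by
  rw [pi_gaussian_eq, integral_withDensity_eq_integral_toReal_smul]
  · rw [← integral_const_mul]
    congr 1; ext u
    rw [ENNReal.toReal_ofReal (Finset.prod_nonneg fun i _ => gaussianPDFReal_nonneg _ _ _),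
      prod_pdf, smul_eq_mul, ← mul_assoc, ← mul_assoc, ← mul_pow, mul_inv_cancel₀ (by positivity)]
    simp
  · simp_rw [prod_pdf, dotProduct]; fun_prop
  · exact ae_of_all _ fun u => ENNReal.ofReal_lt_top

lemma integrable_exp_dot : Integrable (fun u : n → ℝ => Real.exp (-(u ⬝ᵥ u) / 2)) := by
  have := Integrable.fintype_prod (μ := fun _ : n => (volume : Measure ℝ))
    (f := fun _ => gaussianPDFReal 0 1) (fun i => (integrable_gaussianPDFReal 0 1))
  simp_rw [prod_pdf] at this
  rw [← volume_pi] at this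
  refine (this.const_mul ((√(2 * π)) ^ (Fintype.card n))).congr (ae_of_all _ fun u => ?_)
  simp only
  rw [ ← mul_assoc, ← mul_pow, mul_inv_cancel₀ (by positivity)]
  simp

lemma gaussN (a : n → ℝ) (b : ℝ) :
    ∫ u, Real.exp (-(u ⬝ᵥ u) / 2) * nCdf (a ⬝ᵥ u + b) = (√(2 * π)) ^ (Fintype.card n) *
      nCdf (b / √(1 + a ⬝ᵥ a)) := by
  have ha : 0 ≤ a ⬝ᵥ a := Finset.sum_nonneg fun i _ => mul_self_nonneg _
  have h := gauss1 (a ⬝ᵥ a).toNNReal b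
  rw [Real.coe_toNNReal _ ha, ← map_dot_pi, integral_map] at h
  · rw [integral_pi_gaussian (fun u => nCdf (a ⬝ᵥ u + b)), h]
  · exact Measurable.aemeasurable (by unfold dotProduct; fun_prop)
  · exact (measurable_nCdf.comp (by fun_prop)).aestronglyMeasurable

variable [DecidableEq n]

lemma cov_integral (M : Matrix n n ℝ) (hM : M.det ≠ 0) (g : (n → ℝ) → ℝ) :
    ∫ x, g (M *ᵥ x) = |M.det|⁻¹ * ∫ u, g u := by
  have h := Real.map_matrix_volume_pi_eq_smul_volume_pi hM
  have e := (Matrix.toLinearEquiv' M (M.invertibleOfIsUnitDet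
    (isUnit_iff_ne_zero.2 hM))).toContinuousLinearEquiv.toHomeomorph.toMeasurableEquiv
  have hemb : MeasurableEmbedding (Matrix.toLin' M) :=
    (Matrix.toLinearEquiv' M (M.invertibleOfIsUnitDet
    (isUnit_iff_ne_zero.2 hM))).toContinuousLinearEquiv.toHomeomorph.measurableEmbedding
  have h2 := hemb.integral_map (μ := volume) g
  rw [h, integral_smul_measure] at h2
  simp only [Matrix.toLin'_apply] at h2
  rw [← h2, ENNReal.toReal_ofReal (abs_nonneg _), abs_inv, smul_eq_mul]

lemma cov_integrable (M : Matrix n n ℝ) (hM : M.det ≠ 0) (g : (n → ℝ) → ℝ) (hg : Integrable g) :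
    Integrable (fun x => g (M *ᵥ x)) := by
  have h := Real.map_matrix_volume_pi_eq_smul_volume_pi hM
  have hemb : MeasurableEmbedding (Matrix.toLin' M) :=
    (Matrix.toLinearEquiv' M (M.invertibleOfIsUnitDet
    (isUnit_iff_ne_zero.2 hM))).toContinuousLinearEquiv.toHomeomorph.measurableEmbedding
  have h2 := hemb.integrable_map_iff (μ := volume) (g := g)
  rw [h] at h2
  exact h2.1 (hg.smul_measure ENNReal.ofReal_ne_top)

lemma exists_factor (P : Matrix n n ℝ) (hP : P.PosDef) : ∃ C : Matrix n n ℝ, P = Cᵀ * C := by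
  classical
  open scoped MatrixOrder in
  obtain ⟨C, hC⟩ := CStarAlgebra.nonneg_iff_eq_star_mul_self.mp hP.posSemidef.nonneg
  exact ⟨C, by simpa [Matrix.star_eq_conjTranspose] using hC⟩

lemma gaussM (P : Matrix n n ℝ) (hP : P.PosDef) (t : ℝ) (ht : 0 < t) (m a : n → ℝ) (b : ℝ) :
    Integrable (fun x : n → ℝ => Real.exp (-t * ((x - m) ⬝ᵥ P⁻¹ *ᵥ (x - m))) * nCdf (a ⬝ᵥ x + b)) ∧
    ∫ x : n → ℝ, Real.exp (-t * ((x - m) ⬝ᵥ P⁻¹ *ᵥ (x - m))) * nCdf (a ⬝ᵥ x + b) =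
      √(π / t) ^ (Fintype.card n) * √P.det *
        nCdf ((a ⬝ᵥ m + b) / √(1 + (a ⬝ᵥ P *ᵥ a) / (2 * t))) := by
  obtain ⟨C, hC⟩ := exists_factor _ hP.inv
  have hPd : 0 < P.det := hP.det_pos
  have hCd : C.det ^ 2 = P.det⁻¹ := by
    have := congrArg Matrix.det hC
    rw [Matrix.det_nonsing_inv, Matrix.det_mul, Matrix.det_transpose, Ring.inverse_eq_inv'] at this
    rw [this, sq]
  have hC0 : C.det ≠ 0 := by
    intro h; rw [h] at hCd
    have : 0 < P.det⁻¹ := inv_pos.2 hPd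
    simp at hCd; linarith
  have hCu : IsUnit C.det := isUnit_iff_ne_zero.2 hC0
  set M : Matrix n n ℝ := √(2 * t) • C with hMdef
  have hs : 0 < √(2 * t) := by positivity
  have hMd : M.det ≠ 0 := by
    rw [hMdef, Matrix.det_smul]; positivity
  have hMu : IsUnit M.det := isUnit_iff_ne_zero.2 hMd
  have hquad : ∀ x : n → ℝ, -t * (x ⬝ᵥ P⁻¹ *ᵥ x) = -((M *ᵥ x) ⬝ᵥ (M *ᵥ x)) / 2 := by
    intro x
    rw [hC, hMdef, Matrix.smul_mulVec, dotProduct_smul, smul_dotProduct, ← Matrix.mulVec_mulVec,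
      Matrix.dotProduct_mulVec, Matrix.vecMul_transpose]
    simp only [smul_eq_mul]
    rw [← mul_assoc, Real.mul_self_sqrt (by positivity)]; ring
  have hPM : M⁻¹ * M⁻¹ᵀ = (2 * t)⁻¹ • P := by
    have h1 : P = C⁻¹ * C⁻¹ᵀ := by
      rw [← Matrix.nonsing_inv_nonsing_inv P hP.det_pos.ne'.isUnit, hC, Matrix.mul_inv_rev,
        Matrix.transpose_nonsing_inv]
    have h2 : M⁻¹ = (√(2 * t))⁻¹ • C⁻¹ := by
      apply Matrix.inv_eq_right_inv
      rw [hMdef, Matrix.smul_mul, Matrix.mul_smul, smul_smul, mul_inv_cancel₀ hs.ne', one_smul,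
        Matrix.mul_nonsing_inv _ hCu]
    rw [h2, Matrix.transpose_smul, Matrix.smul_mul, Matrix.mul_smul, smul_smul, ← mul_inv,
      Real.mul_self_sqrt (by positivity), ← h1]
  set a' : n → ℝ := a ᵥ* M⁻¹ with ha'
  have haa : ∀ x : n → ℝ, a ⬝ᵥ x = a' ⬝ᵥ (M *ᵥ x) := by
    intro x
    rw [ha', ← Matrix.dotProduct_mulVec, Matrix.mulVec_mulVec, Matrix.nonsing_inv_mul _ hMu,
      Matrix.one_mulVec]
  have ha2 : a' ⬝ᵥ a' = (a ⬝ᵥ P *ᵥ a) / (2 * t) := by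
    have : a' ⬝ᵥ a' = a ⬝ᵥ (M⁻¹ * M⁻¹ᵀ) *ᵥ a := by
      rw [ha', ← Matrix.mulVec_mulVec, Matrix.mulVec_transpose, ← Matrix.dotProduct_mulVec]
    rw [this, hPM, Matrix.smul_mulVec, dotProduct_smul, smul_eq_mul]; ring
  obtain ⟨g, hg⟩ : ∃ g : (n → ℝ) → ℝ, g = fun u => Real.exp (-(u ⬝ᵥ u) / 2) *
    nCdf (a' ⬝ᵥ u + (a ⬝ᵥ m + b)) := ⟨_, rfl⟩
  have key : (fun x : n → ℝ => Real.exp (-t * ((x - m) ⬝ᵥ P⁻¹ *ᵥ (x - m))) * nCdf (a ⬝ᵥ x + b)) =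
    fun x => (fun y => g (M *ᵥ y)) (x - m) := by
    ext x
    simp only [hg]
    rw [hquad, ← haa, dotProduct_sub]
    congr 2; ring
  rw [key]
  constructor
  · refine Integrable.comp_sub_right (f := fun y => g (M *ᵥ y)) ?_ m
    apply cov_integrable M hMd
    rw [hg]
    refine integrable_exp_dot.mono' (Measurable.aestronglyMeasurable ?_) (ae_of_all _ fun u => ?_)
    · exact Measurable.mul (by unfold dotProduct; fun_prop)
        (measurable_nCdf.comp (by unfold dotProduct; fun_prop))
    · rw [norm_mul, Real.norm_of_nonneg (Real.exp_nonneg _), Real.norm_of_nonneg (nCdf_nonneg _)]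
      exact mul_le_of_le_one_right (Real.exp_nonneg _) (nCdf_le_one _)
  · rw [integral_sub_right_eq_self (fun y => g (M *ᵥ y)) m, cov_integral M hMd, hg, gaussN, ha2,
      ← mul_assoc]
    congr 1
    have e1 : |C.det| = (√P.det)⁻¹ := by
      rw [← Real.sqrt_sq_eq_abs, hCd, Real.sqrt_inv]
    rw [hMdef, Matrix.det_smul, abs_mul, e1, abs_of_pos (by positivity), mul_inv, inv_inv,
      mul_right_comm, ← inv_pow, ← mul_pow, ← Real.sqrt_inv, ← Real.sqrt_mul (by positivity)]
    congr 3
    field_simp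

lemma mix (ν N Q L κ : ℝ) (hν : 0 < ν) (hN : 0 ≤ N) (hQ : 0 ≤ Q) :
    nctCdf (L * √((ν + N) / (ν + Q))) κ (ν + N) =
      (1 + Q / ν) ^ ((ν + N) / 2) / Real.Gamma ((ν + N) / 2) *
        ∫ v in Set.Ioi (0 : ℝ), v ^ ((ν + N) / 2 - 1) * Real.exp (-(v * (1 + Q / ν))) *
          nCdf (L * √(2 * v / ν) - κ) := by
  set c : ℝ := 1 + Q / ν with hc
  have hcpos : 0 < c := by positivity
  unfold nctCdf
  have h := integral_comp_mul_left_Ioi' (fun v => v ^ ((ν + N) / 2 - 1) * Real.exp (-v) /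
      Real.Gamma ((ν + N) / 2) *
      nCdf (L * √((ν + N) / (ν + Q)) * √(2 * v / (ν + N)) - κ)) 0 hcpos
  rw [mul_zero] at h
  rw [← h, smul_eq_mul, ← integral_const_mul, ← integral_const_mul]
  refine setIntegral_congr_fun measurableSet_Ioi fun v hv => ?_
  have hv : 0 < v := hv
  have e1 : √((ν + N) / (ν + Q)) * √(2 * (c * v) / (ν + N)) = √(2 * v / ν) := by
    rw [← Real.sqrt_mul (by positivity)]
    congr 1
    rw [hc]
    have : ν + Q ≠ 0 := by positivity
    have : ν + N ≠ 0 := by positivity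
    field_simp
  rw [mul_assoc L, e1, Real.mul_rpow hcpos.le hv.le, Real.rpow_sub_one hcpos.ne', mul_comm c v]
  field_simp

lemma mix_integrable (ν N Q L κ : ℝ) (hν : 0 < ν) (hN : 0 ≤ N) (hQ : 0 ≤ Q) :
    IntegrableOn (fun v => v ^ ((ν + N) / 2 - 1) * Real.exp (-(v * (1 + Q / ν))) *
          nCdf (L * √(2 * v / ν) - κ)) (Set.Ioi (0 : ℝ)) := by
  have h := Real.GammaIntegral_convergent (s := (ν + N) / 2) (by positivity)
  refine Integrable.mono' h (Measurable.aestronglyMeasurable ?_) ?_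
  · exact Measurable.mul (by fun_prop) (measurable_nCdf.comp (by fun_prop))
  · refine (ae_restrict_iff' measurableSet_Ioi).2 (ae_of_all _ fun v hv => ?_)
    have hv : 0 < v := hv
    rw [norm_mul, norm_mul, Real.norm_of_nonneg (Real.exp_nonneg _),
      Real.norm_of_nonneg (nCdf_nonneg _), Real.norm_of_nonneg (by positivity)]
    refine (mul_le_of_le_one_right (by positivity) (nCdf_le_one _)).trans ?_
    rw [mul_comm]
    gcongr
    have : 0 ≤ v * (Q / ν) := by positivity
    nlinarith

lemma marg_core (P : Matrix n n ℝ) (hP : P.PosDef) (ν N QI ℓ κ : ℝ) (m β : n → ℝ)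
    (hν : 0 < ν) (hN : 0 ≤ N) (hQ : 0 ≤ QI) :
    ∫ y : n → ℝ, ∫ v in Set.Ioi (0 : ℝ), v ^ ((ν + (N + Fintype.card n)) / 2 - 1) *
        Real.exp (-(v * (1 + (QI + (y - m) ⬝ᵥ P⁻¹ *ᵥ (y - m)) / ν))) *
          nCdf ((ℓ + β ⬝ᵥ y) * √(2 * v / ν) - κ) =
      √(ν * π) ^ (Fintype.card n) * √P.det *
      ∫ v in Set.Ioi (0 : ℝ), v ^ ((ν + N) / 2 - 1) *
        Real.exp (-(v * (1 + QI / ν))) *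
          nCdf ((ℓ + β ⬝ᵥ m) / √(1 + β ⬝ᵥ P *ᵥ β) * √(2 * v / ν) - κ / √(1 + β ⬝ᵥ P *ᵥ β)) := by
  obtain ⟨f, hf⟩ : ∃ f : (n → ℝ) → ℝ → ℝ, f = fun y v => v ^ ((ν + (N + Fintype.card n)) / 2 - 1) *
        Real.exp (-(v * (1 + (QI + (y - m) ⬝ᵥ P⁻¹ *ᵥ (y - m)) / ν))) *
          nCdf ((ℓ + β ⬝ᵥ y) * √(2 * v / ν) - κ) := ⟨_, rfl⟩
  obtain ⟨g, hg⟩ : ∃ g : ℝ → ℝ, g = fun v => √(ν * π) ^ (Fintype.card n) * √P.det *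
      (v ^ ((ν + N) / 2 - 1) * Real.exp (-(v * (1 + QI / ν))) *
          nCdf ((ℓ + β ⬝ᵥ m) / √(1 + β ⬝ᵥ P *ᵥ β) * √(2 * v / ν) - κ / √(1 + β ⬝ᵥ P *ᵥ β))) :=
    ⟨_, rfl⟩
  have hfv : ∀ v : ℝ, 0 < v → Integrable (fun y => f y v) ∧ ∫ y, f y v = g v := by
    intro v hv
    have ht : 0 < v / ν := by positivity
    have hs : 0 < √(2 * v / ν) := by positivity
    obtain ⟨h1, h2⟩ := gaussM P hP (v / ν) ht m (√(2 * v / ν) • β) (ℓ * √(2 * v / ν) - κ)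
    have e : (fun y => f y v) = fun y => (v ^ ((ν + (N + Fintype.card n)) / 2 - 1) *
        Real.exp (-(v * (1 + QI / ν)))) * (Real.exp (-(v / ν) * ((y - m) ⬝ᵥ P⁻¹ *ᵥ (y - m))) *
          nCdf ((√(2 * v / ν) • β) ⬝ᵥ y + (ℓ * √(2 * v / ν) - κ))) := by
      ext y
      rw [hf]
      simp only
      rw [← mul_assoc, mul_assoc _ (Real.exp _) (Real.exp _), ← Real.exp_add, smul_dotProduct,
        smul_eq_mul]
      congr 3 <;> ring
    rw [e]
    refine ⟨h1.const_mul _, ?_⟩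
    rw [integral_const_mul, h2, hg]
    simp only
    have e2 : 1 + (√(2 * v / ν) • β) ⬝ᵥ P *ᵥ (√(2 * v / ν) • β) / (2 * (v / ν)) =
        1 + β ⬝ᵥ P *ᵥ β := by
      rw [Matrix.mulVec_smul, smul_dotProduct, dotProduct_smul, smul_eq_mul, smul_eq_mul,
        ← mul_assoc, Real.mul_self_sqrt (by positivity)]
      field_simp
    rw [e2, smul_dotProduct, smul_eq_mul]
    have e3 : (√(2 * v / ν) * β ⬝ᵥ m + (ℓ * √(2 * v / ν) - κ)) / √(1 + β ⬝ᵥ P *ᵥ β) =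
      (ℓ + β ⬝ᵥ m) / √(1 + β ⬝ᵥ P *ᵥ β) * √(2 * v / ν) - κ / √(1 + β ⬝ᵥ P *ᵥ β) := by ring
    rw [e3]
    have e4 : v ^ ((ν + (N + Fintype.card n)) / 2 - 1) * √(π / (v / ν)) ^ (Fintype.card n) =
        √(ν * π) ^ (Fintype.card n) * v ^ ((ν + N) / 2 - 1) := by
      have a1 : √(π / (v / ν)) = √(ν * π) * (√v)⁻¹ := by
        rw [← Real.sqrt_inv, ← Real.sqrt_mul (by positivity)]
        congr 1; field_simp
      have a2 : v ^ ((ν + (N + Fintype.card n)) / 2 - 1) =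
          v ^ ((ν + N) / 2 - 1) * √v ^ (Fintype.card n) := by
        rw [Real.sqrt_eq_rpow, ← Real.rpow_natCast, ← Real.rpow_mul hv.le, ← Real.rpow_add hv]
        congr 1; ring
      have : √v ≠ 0 := by positivity
      rw [a1, a2, mul_pow, inv_pow]
      field_simp
    linear_combination (Real.exp (-(v * (1 + QI / ν))) * √P.det *
      nCdf ((ℓ + β ⬝ᵥ m) / √(1 + β ⬝ᵥ P *ᵥ β) * √(2 * v / ν) - κ / √(1 + β ⬝ᵥ P *ᵥ β))) * e4
  have hgi : IntegrableOn g (Set.Ioi 0) := by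
    rw [hg]
    exact (mix_integrable ν N QI _ _ hν hN hQ).const_mul _
  have hfm : Measurable (Function.uncurry f) := by
    rw [hf]
    unfold Function.uncurry dotProduct mulVec dotProduct
    refine Measurable.mul (by fun_prop) (measurable_nCdf.comp (by fun_prop))
  have hint : Integrable (Function.uncurry f)
      ((volume : Measure (n → ℝ)).prod (volume.restrict (Set.Ioi (0:ℝ)))) := by
    rw [integrable_prod_iff' hfm.aestronglyMeasurable]
    constructor
    · exact (ae_restrict_iff' measurableSet_Ioi).2 (ae_of_all _ fun v hv => (hfv v hv).1)
    · refine hgi.congr ((ae_restrict_iff' measurableSet_Ioi).2 (ae_of_all _ fun v hv => ?_))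
      rw [← (hfv v hv).2]
      refine integral_congr_ae (ae_of_all _ fun y => ?_)
      have hv : 0 < v := hv
      have := nCdf_nonneg ((ℓ + β ⬝ᵥ y) * √(2 * v / ν) - κ)
      simp only [Function.uncurry]
      rw [Real.norm_of_nonneg]
      rw [hf]; positivity
  have hsw := integral_integral_swap hint
  rw [← integral_const_mul]
  calc _ = ∫ y, ∫ v in Set.Ioi (0:ℝ), f y v := by rw [hf]
    _ = _ := hsw
    _ = ∫ v in Set.Ioi (0:ℝ), g v := setIntegral_congr_fun measurableSet_Ioi fun v hv => (hfv v hv).2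
    _ = _ := by rw [hg]

lemma quad_inv_nonneg (Ω : Matrix n n ℝ) (hΩ : Ω.PosDef) (x : n → ℝ) : 0 ≤ x ⬝ᵥ Ω⁻¹ *ᵥ x := by
  simpa using hΩ.inv.posSemidef.dotProduct_mulVec_nonneg x

lemma skew_eq (μ : n → ℝ) (Ω : Matrix n n ℝ) (hΩ : Ω.PosDef) (α : n → ℝ) (τ κ ν : ℝ) (hν : 0 < ν)
    (y : n → ℝ) (β : n → ℝ) (hβ : ∀ i, β i = α i / √(Ω i i)) :
    skewTPdf μ Ω α τ κ ν y =
      (Real.Gamma (ν / 2) * √(ν * π) ^ (Fintype.card n) * √Ω.det)⁻¹ *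
        (∫ v in Set.Ioi (0 : ℝ), v ^ ((ν + Fintype.card n) / 2 - 1) *
          Real.exp (-(v * (1 + ((y - μ) ⬝ᵥ Ω⁻¹ *ᵥ (y - μ)) / ν))) *
          nCdf ((β ⬝ᵥ (y - μ) + τ) * √(2 * v / ν) - κ)) /
      nctCdf (τ / √(1 + β ⬝ᵥ Ω *ᵥ β)) (κ / √(1 + β ⬝ᵥ Ω *ᵥ β)) ν := by
  have hd : ∀ i, 0 < √(Ω i i) := fun i => Real.sqrt_pos.2 hΩ.diag_pos
  set ω : Matrix n n ℝ := Matrix.diagonal fun i => √(Ω i i) with hω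
  have hωi : ω⁻¹ = Matrix.diagonal fun i => (√(Ω i i))⁻¹ := by
    apply Matrix.inv_eq_right_inv
    rw [hω, Matrix.diagonal_mul_diagonal, ← Matrix.diagonal_one]
    congr 1; ext i; exact mul_inv_cancel₀ (hd i).ne'
  have hωu : IsUnit ω.det := by
    rw [hω, Matrix.det_diagonal, isUnit_iff_ne_zero]
    exact Finset.prod_ne_zero_iff.2 fun i _ => (hd i).ne'
  have hβω : β = ω⁻¹ *ᵥ α := by
    ext i; rw [hωi, Matrix.mulVec_diagonal, hβ, div_eq_inv_mul]
  have hsym : ω⁻¹ᵀ = ω⁻¹ := by rw [hωi, Matrix.diagonal_transpose]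
  have hdotl : ∀ u w : n → ℝ, u ⬝ᵥ ω⁻¹ *ᵥ w = (ω⁻¹ *ᵥ u) ⬝ᵥ w := by
    intro u w
    rw [Matrix.dotProduct_mulVec, ← Matrix.mulVec_transpose, hsym]
  have hΩbi : (ω⁻¹ * Ω * ω⁻¹)⁻¹ = ω * Ω⁻¹ * ω := by
    rw [Matrix.mul_inv_rev, Matrix.mul_inv_rev, Matrix.nonsing_inv_nonsing_inv _ hωu, Matrix.mul_assoc]
  have hQ1 : α ⬝ᵥ (ω⁻¹ * Ω * ω⁻¹) *ᵥ α = β ⬝ᵥ Ω *ᵥ β := by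
    rw [← Matrix.mulVec_mulVec, ← Matrix.mulVec_mulVec, hdotl, ← hβω]
  have hQ2 : ∀ x : n → ℝ, (ω⁻¹ *ᵥ x) ⬝ᵥ (ω⁻¹ * Ω * ω⁻¹)⁻¹ *ᵥ (ω⁻¹ *ᵥ x) = x ⬝ᵥ Ω⁻¹ *ᵥ x := by
    intro x
    rw [hΩbi, ← hdotl, Matrix.mulVec_mulVec, Matrix.mulVec_mulVec]
    congr 2
    rw [Matrix.mul_assoc ω, ← Matrix.mul_assoc, Matrix.nonsing_inv_mul _ hωu,
      Matrix.one_mul, Matrix.mul_assoc, Matrix.mul_nonsing_inv _ hωu, Matrix.mul_one]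
  have hx : (fun i => y i - μ i) = y - μ := rfl
  unfold skewTPdf
  simp only
  rw [← hω, hx, hQ1, hQ2, hdotl, ← hβω, mix ν _ _ _ κ hν (by positivity) (quad_inv_nonneg Ω hΩ _)]
  congr 1
  rw [← mul_assoc]
  congr 1
  unfold tPdf
  have hc : 0 < 1 + (y - μ) ⬝ᵥ Ω⁻¹ *ᵥ (y - μ) / ν := by
    have := quad_inv_nonneg Ω hΩ (y - μ); positivity
  have hG : Real.Gamma ((ν + Fintype.card n) / 2) ≠ 0 := (Real.Gamma_pos_of_pos (by positivity)).ne'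
  have hp : (ν * π) ^ ((Fintype.card n : ℝ) / 2) = √(ν * π) ^ (Fintype.card n) := by
    rw [Real.sqrt_eq_rpow, ← Real.rpow_natCast, ← Real.rpow_mul (by positivity)]
    congr 1; ring
  rw [hp, neg_div, Real.rpow_neg hc.le]
  have := (Real.rpow_pos_of_pos hc ((ν + Fintype.card n) / 2)).ne'
  generalize (1 + (y - μ) ⬝ᵥ Ω⁻¹ *ᵥ (y - μ) / ν) ^ ((ν + (Fintype.card n : ℝ)) / 2) = r at this ⊢
  field_simp

variable {m : Type*} [Fintype m] [DecidableEq m]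

lemma block_quad (A : Matrix m m ℝ) (hA : A.PosDef) (B : Matrix m n ℝ) (D : Matrix n n ℝ)
    (x : m → ℝ) (y : n → ℝ) :
    Sum.elim x y ⬝ᵥ (Matrix.fromBlocks A B Bᵀ D) *ᵥ Sum.elim x y =
      (x + A⁻¹ *ᵥ B *ᵥ y) ⬝ᵥ A *ᵥ (x + A⁻¹ *ᵥ B *ᵥ y) + y ⬝ᵥ (D - Bᵀ * A⁻¹ * B) *ᵥ y := by
  have := A.invertibleOfIsUnitDet (isUnit_iff_ne_zero.2 hA.det_pos.ne')
  have := Matrix.schur_complement_eq₁₁ B D x y hA.isHermitian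
  simpa [Matrix.dotProduct_mulVec] using this

lemma block_inv_quad (A : Matrix m m ℝ) (hA : A.PosDef) (B : Matrix m n ℝ) (D : Matrix n n ℝ)
    (hM : (Matrix.fromBlocks A B Bᵀ D).PosDef) :
    (D - Bᵀ * A⁻¹ * B).PosDef ∧
    (Matrix.fromBlocks A B Bᵀ D).det = A.det * (D - Bᵀ * A⁻¹ * B).det ∧
    ∀ (x : m → ℝ) (y : n → ℝ),
    Sum.elim x y ⬝ᵥ (Matrix.fromBlocks A B Bᵀ D)⁻¹ *ᵥ Sum.elim x y =
      x ⬝ᵥ A⁻¹ *ᵥ x + (y - Bᵀ *ᵥ A⁻¹ *ᵥ x) ⬝ᵥ (D - Bᵀ * A⁻¹ * B)⁻¹ *ᵥ (y - Bᵀ *ᵥ A⁻¹ *ᵥ x) := by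
  have hAu : IsUnit A.det := isUnit_iff_ne_zero.2 hA.det_pos.ne'
  have hMu : IsUnit (Matrix.fromBlocks A B Bᵀ D).det := isUnit_iff_ne_zero.2 hM.det_pos.ne'
  have hdet : (Matrix.fromBlocks A B Bᵀ D).det = A.det * (D - Bᵀ * A⁻¹ * B).det := by
    have := A.invertibleOfIsUnitDet hAu
    rw [Matrix.det_fromBlocks₁₁, Matrix.invOf_eq_nonsing_inv]
  have hP : (D - Bᵀ * A⁻¹ * B).PosDef := by
    have := A.invertibleOfIsUnitDet hAu
    have h1 := (Matrix.PosDef.fromBlocks₁₁ B D hA).1 (by simpa using hM.posSemidef)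
    rw [Matrix.conjTranspose_eq_transpose_of_trivial] at h1
    rw [h1.posDef_iff_det_ne_zero]
    intro h
    rw [h, mul_zero] at hdet
    exact hM.det_pos.ne' hdet
  have hPu : IsUnit (D - Bᵀ * A⁻¹ * B).det := isUnit_iff_ne_zero.2 hP.det_pos.ne'
  refine ⟨hP, hdet, fun x y => ?_⟩
  obtain ⟨p, q, hpq⟩ : ∃ p q, (Matrix.fromBlocks A B Bᵀ D)⁻¹ *ᵥ Sum.elim x y = Sum.elim p q :=
    ⟨_, _, (Sum.elim_comp_inl_inr _).symm⟩
  have hxy : Sum.elim x y = (Matrix.fromBlocks A B Bᵀ D) *ᵥ Sum.elim p q := by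
    rw [← hpq, Matrix.mulVec_mulVec, Matrix.mul_nonsing_inv _ hMu, Matrix.one_mulVec]
  rw [hpq, dotProduct_comm, hxy, block_quad A hA]
  rw [Matrix.fromBlocks_mulVec] at hxy
  have hx : x = A *ᵥ p + B *ᵥ q := by
    have := congrArg (fun f => f ∘ Sum.inl) hxy
    simpa using this
  have hy : y = Bᵀ *ᵥ p + D *ᵥ q := by
    have := congrArg (fun f => f ∘ Sum.inr) hxy
    simpa using this
  have h1 : A⁻¹ *ᵥ x = p + A⁻¹ *ᵥ B *ᵥ q := by
    rw [hx, Matrix.mulVec_add, Matrix.mulVec_mulVec p, Matrix.nonsing_inv_mul _ hAu,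
      Matrix.one_mulVec]
  have h2 : x = A *ᵥ (p + A⁻¹ *ᵥ B *ᵥ q) := by
    rw [← h1, Matrix.mulVec_mulVec, Matrix.mul_nonsing_inv _ hAu, Matrix.one_mulVec]
  have h3 : y - Bᵀ *ᵥ A⁻¹ *ᵥ x = (D - Bᵀ * A⁻¹ * B) *ᵥ q := by
    rw [h1, hy, Matrix.mulVec_add, Matrix.sub_mulVec, ← Matrix.mulVec_mulVec,
      ← Matrix.mulVec_mulVec]
    abel
  rw [h3, Matrix.mulVec_mulVec q (D - Bᵀ * A⁻¹ * B)⁻¹, Matrix.nonsing_inv_mul _ hPu, Matrix.one_mulVec, h1, ← h2,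
    dotProduct_comm, dotProduct_comm q]

variable {ι : Type*} [Fintype ι] [DecidableEq ι]

lemma marg_gen (e : m ⊕ n ≃ ι) (Ω : Matrix ι ι ℝ) (hΩ : Ω.PosDef) (μ α : ι → ℝ) (τ κ ν : ℝ)
    (hν : 0 < ν) (A : Matrix m m ℝ) (B : Matrix m n ℝ) (D : Matrix n n ℝ)
    (hM : Ω.submatrix e e = Matrix.fromBlocks A B Bᵀ D) (β : ι → ℝ)
    (hβ : ∀ i, β i = α i / √(Ω i i)) (βI : m → ℝ) (βC : n → ℝ)
    (hβe : β ∘ e = Sum.elim βI βC) (den : ℝ)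
    (hden : den = √(1 + βC ⬝ᵥ (D - Bᵀ * A⁻¹ * B) *ᵥ βC)) (αs μI : m → ℝ) (μC : n → ℝ)
    (hμ : μ ∘ e = Sum.elim μI μC)
    (hαs : ∀ i, (βI i + (A⁻¹ *ᵥ B *ᵥ βC) i) / den = αs i / √(A i i)) (yI : m → ℝ) :
    ∫ yC : n → ℝ, skewTPdf μ Ω α τ κ ν (fun i => Sum.elim yI yC (e.symm i)) =
      skewTPdf μI A αs (τ / den) (κ / den) ν yI := by
  have hMp : (Matrix.fromBlocks A B Bᵀ D).PosDef := by
    rw [← hM]; exact hΩ.submatrix e.injective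
  have hA : A.PosDef := by
    have : A = (Matrix.fromBlocks A B Bᵀ D).submatrix Sum.inl Sum.inl := by ext; simp
    rw [this]; exact hMp.submatrix Sum.inl_injective
  obtain ⟨hP, hdet, hquad⟩ := block_inv_quad A hA B D hMp
  set P := D - Bᵀ * A⁻¹ * B with hPdef
  have hΩdet : Ω.det = A.det * P.det := by
    rw [← hdet, ← hM, Matrix.det_submatrix_equiv_self]
  have hAs : A⁻¹ᵀ = A⁻¹ := by simpa using hA.inv.isHermitian.eq
  have hdotA : ∀ u w : m → ℝ, (A⁻¹ *ᵥ u) ⬝ᵥ w = u ⬝ᵥ A⁻¹ *ᵥ w := by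
    intro u w
    rw [Matrix.dotProduct_mulVec, ← Matrix.mulVec_transpose, hAs]
  have hPnn : 0 ≤ βC ⬝ᵥ P *ᵥ βC := by simpa using hP.posSemidef.dotProduct_mulVec_nonneg βC
  have hdpos : 0 < den := by rw [hden]; positivity
  have hdsq : den ^ 2 = 1 + βC ⬝ᵥ P *ᵥ βC := by rw [hden, Real.sq_sqrt (by positivity)]
  set γ : m → ℝ := βI + A⁻¹ *ᵥ B *ᵥ βC with hγ
  have hβΩβ : β ⬝ᵥ Ω *ᵥ β = γ ⬝ᵥ A *ᵥ γ + βC ⬝ᵥ P *ᵥ βC := by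
    rw [hγ, hPdef, ← block_quad A hA, ← hβe, ← hM, Matrix.submatrix_mulVec_equiv,
      Function.comp_assoc, Equiv.self_comp_symm, Function.comp_id, comp_equiv_dotProduct_comp_equiv]
  have hAnn : 0 ≤ γ ⬝ᵥ A *ᵥ γ := by simpa using hA.posSemidef.dotProduct_mulVec_nonneg γ
  have hz : ∀ yC : n → ℝ, (fun i => Sum.elim yI yC (e.symm i)) - μ =
      Sum.elim (yI - μI) (yC - μC) ∘ e.symm := by
    intro yC
    ext i
    obtain ⟨j, rfl⟩ := e.surjective i
    have := congrFun hμ j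
    simp only [Function.comp] at this
    rcases j with j | j <;> simp [this]
  have hQ : ∀ z : m ⊕ n → ℝ, (z ∘ e.symm) ⬝ᵥ Ω⁻¹ *ᵥ (z ∘ e.symm) =
      z ⬝ᵥ (Matrix.fromBlocks A B Bᵀ D)⁻¹ *ᵥ z := by
    intro z
    rw [← hM, Matrix.inv_submatrix_equiv, Matrix.submatrix_mulVec_equiv,
      ← comp_equiv_dotProduct_comp_equiv _ _ e, Function.comp_assoc, Equiv.symm_comp_self,
      Function.comp_id]
  have hL : ∀ z : m ⊕ n → ℝ, β ⬝ᵥ (z ∘ e.symm) = Sum.elim βI βC ⬝ᵥ z := by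
    intro z
    rw [← hβe, ← comp_equiv_dotProduct_comp_equiv _ _ e, Function.comp_assoc z,
      Equiv.symm_comp_self, Function.comp_id]
  have hcard : (Fintype.card ι : ℕ) = Fintype.card m + Fintype.card n := by
    rw [← Fintype.card_congr e, Fintype.card_sum]
  set xI := yI - μI with hxI
  set m0 : n → ℝ := μC + Bᵀ *ᵥ A⁻¹ *ᵥ xI with hm0
  have hcore := marg_core P hP ν (Fintype.card m) (xI ⬝ᵥ A⁻¹ *ᵥ xI)
    (βI ⬝ᵥ xI - βC ⬝ᵥ μC + τ) κ m0 βC hν (by positivity) (quad_inv_nonneg A hA xI)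
  have hrhs := skew_eq μI A hA αs (τ / den) (κ / den) ν hν yI (fun i => γ i / den)
    (fun i => by rw [← hαs i]; rfl)
  have hγd : (fun i => γ i / den) = den⁻¹ • γ := by
    ext i; simp [div_eq_inv_mul]
  have hnorm : √(1 + (den⁻¹ • γ) ⬝ᵥ A *ᵥ (den⁻¹ • γ)) = √(1 + β ⬝ᵥ Ω *ᵥ β) / den := by
    have : 1 + (den⁻¹ • γ) ⬝ᵥ A *ᵥ (den⁻¹ • γ) = (1 + β ⬝ᵥ Ω *ᵥ β) / den ^ 2 := by
      rw [Matrix.mulVec_smul, smul_dotProduct, dotProduct_smul, hβΩβ, smul_eq_mul, smul_eq_mul]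
      field_simp
      rw [hdsq]; ring
    rw [this, Real.sqrt_div (by rw [hβΩβ]; positivity), Real.sqrt_sq hdpos.le]
  have hsp : 0 < √(1 + β ⬝ᵥ Ω *ᵥ β) := by rw [hβΩβ]; positivity
  have hdd : ∀ c : ℝ, c / den / (√(1 + β ⬝ᵥ Ω *ᵥ β) / den) = c / √(1 + β ⬝ᵥ Ω *ᵥ β) := by
    intro c; field_simp
  rw [hrhs, hγd, hnorm, hdd, hdd]
  have hell : (βI ⬝ᵥ xI - βC ⬝ᵥ μC + τ + βC ⬝ᵥ m0) / den = (den⁻¹ • γ) ⬝ᵥ xI + τ / den := by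
    have : γ ⬝ᵥ xI = βI ⬝ᵥ xI + βC ⬝ᵥ Bᵀ *ᵥ A⁻¹ *ᵥ xI := by
      rw [hγ, add_dotProduct, hdotA, Matrix.dotProduct_mulVec βC, Matrix.vecMul_transpose]
    rw [smul_dotProduct, smul_eq_mul, this, hm0, dotProduct_add]
    field_simp
    ring
  rw [← hden, hell] at hcore
  have hint : ∀ yC : n → ℝ, skewTPdf μ Ω α τ κ ν (fun i => Sum.elim yI yC (e.symm i)) =
      (Real.Gamma (ν / 2) * √(ν * π) ^ (Fintype.card ι) * √Ω.det)⁻¹ *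
      (nctCdf (τ / √(1 + β ⬝ᵥ Ω *ᵥ β)) (κ / √(1 + β ⬝ᵥ Ω *ᵥ β)) ν)⁻¹ *
      ∫ v in Set.Ioi (0 : ℝ), v ^ ((ν + (Fintype.card m + Fintype.card n)) / 2 - 1) *
        Real.exp (-(v * (1 + (xI ⬝ᵥ A⁻¹ *ᵥ xI + (yC - m0) ⬝ᵥ P⁻¹ *ᵥ (yC - m0)) / ν))) *
          nCdf ((βI ⬝ᵥ xI - βC ⬝ᵥ μC + τ + βC ⬝ᵥ yC) * √(2 * v / ν) - κ) := by
    intro yC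
    rw [skew_eq μ Ω hΩ α τ κ ν hν _ β hβ, hz, hQ, hL, hquad, sumElim_dotProduct_sumElim]
    have e1 : yC - μC - Bᵀ *ᵥ A⁻¹ *ᵥ xI = yC - m0 := by rw [hm0]; abel
    have e2 : βI ⬝ᵥ xI + βC ⬝ᵥ (yC - μC) + τ = βI ⬝ᵥ xI - βC ⬝ᵥ μC + τ + βC ⬝ᵥ yC := by
      have e0 : βC ⬝ᵥ (yC - μC) = βC ⬝ᵥ yC - βC ⬝ᵥ μC := dotProduct_sub _ _ _
      rw [e0]; ring
    rw [e1, e2]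
    have e3 : ((Fintype.card ι : ℕ) : ℝ) = Fintype.card m + Fintype.card n := by
      rw [hcard]; push_cast; rfl
    rw [e3]
    ring
  simp_rw [hint]
  rw [integral_const_mul, hcore, hΩdet, hcard, pow_add, Real.sqrt_mul hA.det_pos.le]
  have h1 : √(ν * π) ^ Fintype.card n ≠ 0 := by positivity
  have h2 : √P.det ≠ 0 := (Real.sqrt_pos.2 hP.det_pos).ne'
  rw [← hxI]
  generalize (∫ v in Set.Ioi (0:ℝ), v ^ ((ν + (Fintype.card m : ℝ)) / 2 - 1) *
    Real.exp (-(v * (1 + xI ⬝ᵥ A⁻¹ *ᵥ xI / ν))) *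
      nCdf (((den⁻¹ • γ) ⬝ᵥ xI + τ / den) * √(2 * v / ν) - κ / den)) = J
  generalize nctCdf (τ / √(1 + β ⬝ᵥ Ω *ᵥ β)) (κ / √(1 + β ⬝ᵥ Ω *ᵥ β)) ν = N
  generalize √(ν * π) ^ Fintype.card n = a at *
  generalize √P.det = b at *
  have h3 : a * a⁻¹ = 1 := mul_inv_cancel₀ h1
  have h4 : b * b⁻¹ = 1 := mul_inv_cancel₀ h2
  simp only [mul_inv, div_eq_mul_inv]
  calc _ = (a * a⁻¹) * (b * b⁻¹) * ((Real.Gamma (ν * 2⁻¹))⁻¹ *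
      (√(ν * π) ^ Fintype.card m)⁻¹ * (√A.det)⁻¹ * J * N⁻¹) := by ring
    _ = _ := by rw [h3, h4]; ring
end helpers

/-- the marginal of a non-central extended skew-t distribution is again
non-central extended skew-t. -/
theorem skewT_marginal
    (d : ℕ) (μ : Fin d → ℝ) (Ω : Matrix (Fin d) (Fin d) ℝ) (hΩ : Ω.PosDef)
    (α : Fin d → ℝ) (τ κ ν : ℝ) (hν : 0 < ν)
    (S : Finset (Fin d)) (hS : S.Nonempty) (hS' : S ≠ Finset.univ) :
    let ω : Matrix (Fin d) (Fin d) ℝ := Matrix.diagonal fun i => Real.sqrt (Ω i i)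
    let Ωb : Matrix (Fin d) (Fin d) ℝ := ω⁻¹ * Ω * ω⁻¹
    let ΩbII : Matrix {i // i ∈ S} {i // i ∈ S} ℝ := fun i j => Ωb i.1 j.1
    let ΩbIC : Matrix {i // i ∈ S} {i // i ∉ S} ℝ := fun i j => Ωb i.1 j.1
    let ΩbCI : Matrix {i // i ∉ S} {i // i ∈ S} ℝ := fun i j => Ωb i.1 j.1
    let ΩbCC : Matrix {i // i ∉ S} {i // i ∉ S} ℝ := fun i j => Ωb i.1 j.1
    let Ωt : Matrix {i // i ∉ S} {i // i ∉ S} ℝ := ΩbCC - ΩbCI * ΩbII⁻¹ * ΩbIC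
    let αI : {i // i ∈ S} → ℝ := fun i => α i.1
    let αC : {i // i ∉ S} → ℝ := fun i => α i.1
    let den : ℝ := Real.sqrt (1 + αC ⬝ᵥ Ωt.mulVec αC)
    let αstar : {i // i ∈ S} → ℝ := fun i => (αI i + ΩbII⁻¹.mulVec (ΩbIC.mulVec αC) i) / den
    let ΩII : Matrix {i // i ∈ S} {i // i ∈ S} ℝ := fun i j => Ω i.1 j.1
    ∀ yI : {i // i ∈ S} → ℝ,
      (∫ yC : {i // i ∉ S} → ℝ,
          skewTPdf μ Ω α τ κ ν fun i => if h : i ∈ S then yI ⟨i, h⟩ else yC ⟨i, h⟩) =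
        skewTPdf (fun i => μ i.1) ΩII αstar (τ / den) (κ / den) ν yI := by
  intro ω Ωb ΩbII ΩbIC ΩbCI ΩbCC Ωt αI αC den αstar ΩII yI
  have hd : ∀ i, 0 < √(Ω i i) := fun i => Real.sqrt_pos.2 hΩ.diag_pos
  have hωi : ω⁻¹ = Matrix.diagonal fun i => (√(Ω i i))⁻¹ := by
    apply Matrix.inv_eq_right_inv
    rw [Matrix.diagonal_mul_diagonal, ← Matrix.diagonal_one]
    congr 1; ext i; exact mul_inv_cancel₀ (hd i).ne'
  have hΩb : ∀ i j, Ωb i j = (√(Ω i i))⁻¹ * Ω i j * (√(Ω j j))⁻¹ := by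
    intro i j
    simp only [Ωb]
    rw [hωi, Matrix.mul_diagonal, Matrix.diagonal_mul]
  let B : Matrix {i // i ∈ S} {i // i ∉ S} ℝ := fun i j => Ω i.1 j.1
  let D : Matrix {i // i ∉ S} {i // i ∉ S} ℝ := fun i j => Ω i.1 j.1
  let WI : Matrix {i // i ∈ S} {i // i ∈ S} ℝ := Matrix.diagonal fun i => (√(Ω i.1 i.1))⁻¹
  let WI' : Matrix {i // i ∈ S} {i // i ∈ S} ℝ := Matrix.diagonal fun i => √(Ω i.1 i.1)
  let WC : Matrix {i // i ∉ S} {i // i ∉ S} ℝ := Matrix.diagonal fun i => (√(Ω i.1 i.1))⁻¹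
  have hsym : ∀ i j, Ω i j = Ω j i := fun i j => by
    have := hΩ.isHermitian.apply j i
    simpa using this
  have hWW : WI' * WI = 1 := by
    rw [Matrix.diagonal_mul_diagonal, ← Matrix.diagonal_one]
    congr 1; ext i; exact mul_inv_cancel₀ (hd i.1).ne'
  have hWW2 : WI * WI' = 1 := by
    rw [Matrix.diagonal_mul_diagonal, ← Matrix.diagonal_one]
    congr 1; ext i; exact inv_mul_cancel₀ (hd i.1).ne'
  have eII : ΩbII = WI * ΩII * WI := by
    ext i j; rw [Matrix.mul_diagonal, Matrix.diagonal_mul]; exact hΩb _ _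
  have eIC : ΩbIC = WI * B * WC := by
    ext i j; rw [Matrix.mul_diagonal, Matrix.diagonal_mul]; exact hΩb _ _
  have eCI : ΩbCI = WC * Bᵀ * WI := by
    ext i j; rw [Matrix.mul_diagonal, Matrix.diagonal_mul, Matrix.transpose_apply]
    have := hΩb i.1 j.1
    rw [hsym i.1 j.1] at this
    exact this
  have eCC : ΩbCC = WC * D * WC := by
    ext i j; rw [Matrix.mul_diagonal, Matrix.diagonal_mul]; exact hΩb _ _
  have eIIi : ΩbII⁻¹ = WI' * ΩII⁻¹ * WI' := by
    have h1 : WI⁻¹ = WI' := Matrix.inv_eq_right_inv hWW2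
    rw [eII, Matrix.mul_inv_rev, Matrix.mul_inv_rev, h1, Matrix.mul_assoc]
  have eX : ΩbII⁻¹ * ΩbIC = WI' * (ΩII⁻¹ * B) * WC := by
    rw [eIIi, eIC]
    calc WI' * ΩII⁻¹ * WI' * (WI * B * WC) = WI' * ΩII⁻¹ * (WI' * WI) * B * WC := by
          simp only [Matrix.mul_assoc]
      _ = _ := by rw [hWW, Matrix.mul_one]; simp only [Matrix.mul_assoc]
  have et : Ωt = WC * (D - Bᵀ * ΩII⁻¹ * B) * WC := by
    simp only [Ωt]
    rw [Matrix.mul_assoc, eX, eCC, eCI]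
    calc _ = WC * D * WC - WC * Bᵀ * (WI * WI') * (ΩII⁻¹ * B) * WC := by
          simp only [Matrix.mul_assoc]
      _ = _ := by
          rw [hWW2, Matrix.mul_one, Matrix.mul_sub, Matrix.sub_mul]; simp only [Matrix.mul_assoc]
  have hβC : WC *ᵥ αC = fun i => α i.1 / √(Ω i.1 i.1) := by
    ext i; rw [Matrix.mulVec_diagonal, div_eq_inv_mul]
  have hden : den = √(1 + (WC *ᵥ αC) ⬝ᵥ (D - Bᵀ * ΩII⁻¹ * B) *ᵥ (WC *ᵥ αC)) := by
    simp only [den]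
    rw [et, ← Matrix.mulVec_mulVec, ← Matrix.mulVec_mulVec, Matrix.dotProduct_mulVec αC,
      ← Matrix.mulVec_transpose, Matrix.diagonal_transpose]
  have e0 : ΩbII⁻¹ *ᵥ ΩbIC *ᵥ αC = WI' *ᵥ (ΩII⁻¹ *ᵥ B *ᵥ (WC *ᵥ αC)) := by
    rw [Matrix.mulVec_mulVec αC ΩbII⁻¹ ΩbIC, eX]
    simp only [Matrix.mulVec_mulVec, Matrix.mul_assoc]
  have e1 : ∀ w i, (WI' *ᵥ w) i = √(Ω i.1 i.1) * w i := fun w i => Matrix.mulVec_diagonal _ _ _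
  have key := marg_gen (Equiv.sumCompl (fun i => i ∈ S)) Ω hΩ μ α τ κ ν hν ΩII B D
    (by
      ext i j
      rcases i with i | i <;> rcases j with j | j
      · rfl
      · rfl
      · exact hsym _ _
      · rfl)
    (fun i => α i / √(Ω i i)) (fun i => rfl) (fun i => α i.1 / √(Ω i.1 i.1)) (WC *ᵥ αC)
    (by rw [hβC]; ext i; rcases i with i | i <;> simp) den hden αstar (fun i => μ i.1)
    (fun i => μ i.1) (by ext i; rcases i with i | i <;> simp)
    (by
      intro i
      simp only [αstar, αI]
      rw [e0, e1]
      have := (hd i.1).ne'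
      have e : √(ΩII i i) = √(Ω i.1 i.1) := rfl
      rw [e]
      generalize (ΩII⁻¹ *ᵥ B *ᵥ (WC *ᵥ αC)) i = w
      generalize √(Ω i.1 i.1) = t at *
      have h3 : t * t⁻¹ = 1 := mul_inv_cancel₀ this
      simp only [div_eq_mul_inv]
      calc _ = (α i.1 * t⁻¹ + (t * t⁻¹) * w) * den⁻¹ := by rw [h3, one_mul]
        _ = _ := by ring) yI
  rw [← key]
  congr 1
  ext yC
  congr 1
  ext i
  by_cases h : i ∈ S
  · simp [h, Equiv.sumCompl_symm_apply_of_pos]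
  · simp [h, Equiv.sumCompl_symm_apply_of_neg]
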